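/- In 2×2×3 Abalone starting from the standard initial constellation C0 (Black's three marbles on one end, Gray's three on the other), if Black moves first then Black's only non-losing first move is to board C1 (moving the right marble broadside into the middle column); all three other nonisomorphic first moves allow Gray to force a win. -/

import Mathlib

/-- An abstract two-player game with perfect information and alternating moves.
`true` denotes Left (Black) and `false` denotes Right (Gray). -/
structure AGame (P : Type*) where
  /-- `move pl p q` : player `pl` has a legal move from position `p` to position `q`. -/
  move : Bool → P → P → Prop
  /-- `win pl p` : the position `p` is a terminal win for player `pl`. -/
  win : Bool → P → Prop

namespace AGame

variable {P : Type*}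

/-- `FW G pl turn p` : player `pl` can force a win (in finitely many moves)
from position `p` when it is `turn`'s move. -/
inductive FW (G : AGame P) (pl : Bool) : Bool → P → Prop
  | terminal (turn : Bool) (p : P) : G.win pl p → FW G pl turn p
  | self (p q : P) : ¬ G.win (!pl) p → G.move pl p q → FW G pl (!pl) q → FW G pl pl p
  | opp (p : P) : ¬ G.win (!pl) p → (∃ q, G.move (!pl) p q) →
      (∀ q, G.move (!pl) p q → FW G pl pl q) → FW G pl (!pl) p

/-- Outcome class `L` : Left (Black) always wins, whoever moves first. -/
def OutL (G : AGame P) (p : P) : Prop := G.FW true true p ∧ G.FW true false p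

/-- Outcome class `R` : Right (Gray) always wins, whoever moves first. -/
def OutR (G : AGame P) (p : P) : Prop := G.FW false false p ∧ G.FW false true p

/-- Outcome class `N` : whoever moves next wins. -/
def OutN (G : AGame P) (p : P) : Prop := G.FW true true p ∧ G.FW false false p

/-- Outcome class `D` : neither player can force a win (optimal play is an infinite draw). -/
def OutD (G : AGame P) (p : P) : Prop :=
  ¬ G.FW true true p ∧ ¬ G.FW true false p ∧ ¬ G.FW false true p ∧ ¬ G.FW false false p

/-- Outcome class `N̂` : Left wins moving first, and the game is a draw if Right moves first. -/
def OutNhat (G : AGame P) (p : P) : Prop :=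
  G.FW true true p ∧ ¬ G.FW true false p ∧ ¬ G.FW false false p

/-- Outcome class `Ň` : Right wins moving first, and the game is a draw if Left moves first. -/
def OutNcheck (G : AGame P) (p : P) : Prop :=
  G.FW false false p ∧ ¬ G.FW false true p ∧ ¬ G.FW true true p

end AGame

namespace Abalone

/-- A board cell, in axial hexagonal coordinates `(q, r)` where `q` is the column. -/
abbrev Cell : Type := ℤ × ℤ

/-- A constellation: each cell carries a black marble (`some true`),
a gray marble (`some false`), or is empty (`none`). -/
abbrev Pos : Type := Cell → Option Bool

/-- The six unit directions of the hexagonal grid. -/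
def dirs : List Cell := [(1, 0), (0, 1), (-1, 1), (-1, 0), (0, -1), (1, -1)]

/-- Add a direction to a cell. -/
def addc (x d : Cell) : Cell := (x.1 + d.1, x.2 + d.2)

/-- The cell `n` steps from `x` in direction `d`. -/
def stepc (x : Cell) (n : ℕ) (d : Cell) : Cell := (x.1 + (n : ℤ) * d.1, x.2 + (n : ℤ) * d.2)

/-- The opposite direction. -/
def negd (d : Cell) : Cell := (-d.1, -d.2)

open Classical in
/-- The result of shifting the line of `len` marbles starting one step after `x`
(in direction `d`, with the marble at `x` itself moving into the vacated space):
cell `x` is vacated, each cell `x + i·d` (`1 ≤ i ≤ len`) receives the content of its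
predecessor, and marbles shifted off the board are removed. -/
noncomputable def shiftResult (board : Finset Cell) (c : Pos) (x d : Cell) (len : ℕ) : Pos :=
  fun y =>
    if y ∉ board then none
    else if y = x then none
    else if ∃ i : ℕ, 1 ≤ i ∧ i ≤ len ∧ y = stepc x i d then c (addc y (negd d))
    else c y

/-- In-line movement (including sumito pushes): player `pl` moves a line of `k` of their
own contiguous marbles (`1 ≤ k ≤ maxG`) one step in the line's direction `d`, possibly
pushing a strictly shorter opposing line of `m < k` marbles, the leading opposing marble
being pushed either onto an empty board cell or off the board. -/
def InlineMove (board : Finset Cell) (maxG : ℕ) (pl : Bool) (c c' : Pos) : Prop :=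
  ∃ x d, d ∈ dirs ∧ ∃ k m : ℕ,
    1 ≤ k ∧ k ≤ maxG ∧ m < k ∧
    (∀ i < k, stepc x i d ∈ board ∧ c (stepc x i d) = some pl) ∧
    (∀ i, k ≤ i → i < k + m → stepc x i d ∈ board ∧ c (stepc x i d) = some (!pl)) ∧
    ((m = 0 ∧ stepc x k d ∈ board ∧ c (stepc x k d) = none) ∨
      (1 ≤ m ∧ (stepc x (k + m) d ∉ board ∨ c (stepc x (k + m) d) = none))) ∧
    c' = shiftResult board c x d (k + m)

open Classical in
/-- The result of a broadside move: the `k` marbles at `x + i·d` (`i < k`) each move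
one step in direction `e`. -/
noncomputable def broadResult (c : Pos) (pl : Bool) (x d e : Cell) (k : ℕ) : Pos :=
  fun y =>
    if ∃ i < k, y = stepc x i d then none
    else if ∃ i < k, y = addc (stepc x i d) e then some pl
    else c y

/-- Broadside movement: player `pl` moves a line of `k` of their own contiguous marbles
(`1 ≤ k ≤ maxG`, the line in direction `d`) one step in a direction `e` not along the
line, each marble landing on an empty board cell. -/
def BroadsideMove (board : Finset Cell) (maxG : ℕ) (pl : Bool) (c c' : Pos) : Prop :=
  ∃ x d e, d ∈ dirs ∧ e ∈ dirs ∧ e ≠ d ∧ e ≠ negd d ∧ ∃ k : ℕ,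
    1 ≤ k ∧ k ≤ maxG ∧
    (∀ i < k, stepc x i d ∈ board ∧ c (stepc x i d) = some pl) ∧
    (∀ i < k, addc (stepc x i d) e ∈ board ∧ c (addc (stepc x i d) e) = none) ∧
    c' = broadResult c pl x d e k

/-- A legal Abalone move for player `pl`. -/
def Move (board : Finset Cell) (maxG : ℕ) (pl : Bool) (c c' : Pos) : Prop :=
  InlineMove board maxG pl c c' ∨ BroadsideMove board maxG pl c c'

/-- The number of marbles of player `pl` on the board. -/
def countM (board : Finset Cell) (pl : Bool) (c : Pos) : ℕ :=
  (board.filter (fun y => c y = some pl)).card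

/-- Player `pl` has won: the opponent has fewer than `n` marbles left,
i.e. at least one opposing marble has been pushed off the board. -/
def Wins (board : Finset Cell) (n : ℕ) (pl : Bool) (c : Pos) : Prop :=
  countM board (!pl) c < n

/-- The negative of a constellation: swap black and gray marbles. -/
def negP (c : Pos) : Pos := fun y => (c y).map (fun b => !b)

end Abalone

namespace Abalone

/-! ### The 2×2×3 Abalone board

A hexagonal grid of 10 cells with columns of sizes 3, 4, 3, labelled as in the paper:
`a, b, c` the left column (bottom to top), `d, e, f, g` the middle column (bottom to
top, with `e, f` the two central spaces), and `h, i, j` the right column (bottom to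
top). Each player has 3 marbles, may move 1–3 contiguous marbles, a strictly longer
line pushes a shorter opposing line, and a player wins by ejecting one opposing
marble. -/

def ca : Cell := (-1, 2)
def cb : Cell := (-1, 1)
def cc : Cell := (-1, 0)
def cd : Cell := (0, 2)
def ce : Cell := (0, 1)
def cf : Cell := (0, 0)
def cg : Cell := (0, -1)
def ch : Cell := (1, 1)
def ci : Cell := (1, 0)
def cj : Cell := (1, -1)

def board223 : Finset Cell := {ca, cb, cc, cd, ce, cf, cg, ch, ci, cj}

/-- 2×2×3 Abalone as a game: moves of 1–3 contiguous marbles, win by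
reducing the opponent to fewer than 3 marbles. -/
def G223 : AGame Pos :=
  { move := Move board223 3
    win := Wins board223 3 }

/-- The constellation with black marbles on `b1, b2, b3` and gray marbles
on `g1, g2, g3`. -/
def mk3 (b1 b2 b3 g1 g2 g3 : Cell) : Pos := fun y =>
  if y = b1 ∨ y = b2 ∨ y = b3 then some true
  else if y = g1 ∨ y = g2 ∨ y = g3 then some false
  else none

/-- The boards `C0`–`C8` of the paper (Figure 8). -/
def C0 : Pos := mk3 cc cg cj ca cd ch
def C1 : Pos := mk3 cc cf cg ca cd ch
def C2 : Pos := mk3 cc cf cg ca cd ce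
def C3 : Pos := mk3 cc cf cg ce cd ch
def C4 : Pos := mk3 cb cf cg ca cd ce
def C5 : Pos := mk3 cc cb cg ca cd ce
def C6 : Pos := mk3 cb cf cg ce cd ci
def C7 : Pos := mk3 cb cc cg ci cd ce
def C8 : Pos := mk3 cc cf cg ci cd ce

/-- A valid 2×2×3 constellation: all marbles on the board,
3 black and 3 gray marbles. -/
def Valid223 (c : Pos) : Prop :=
  (∀ y, y ∉ board223 → c y = none) ∧
  countM board223 true c = 3 ∧ countM board223 false c = 3

/-- `c` contains (up to the symmetries of the board) the neutral subconfiguration: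
two Gray marbles in a corner column pair threaten an adjacent Black marble in the
same column (e.g. Gray on `a` and `b` threatening Black on `c`). -/
def ContainsNeutral (c : Pos) : Prop :=
  (c ca = some false ∧ c cb = some false ∧ c cc = some true) ∨
  (c cb = some false ∧ c cc = some false ∧ c ca = some true) ∨
  (c ch = some false ∧ c ci = some false ∧ c cj = some true) ∨
  (c ci = some false ∧ c cj = some false ∧ c ch = some true)

end Abalone

namespace Abalone

/-- The left–right mirror symmetry of the 2×2×3 board (`a↔h`, `b↔i`, `c↔j`,
fixing the middle column). -/
def symMirror (y : Cell) : Cell := (-y.1, y.1 + y.2)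

/-- The 180° rotation of the 2×2×3 board about its center
(`a↔j`, `b↔i`, `c↔h`, `d↔g`, `e↔f`). -/
def symRot (y : Cell) : Cell := (-y.1, 1 - y.2)

/-- The top–bottom reflection of the 2×2×3 board (`a↔c`, `d↔g`, `e↔f`, `h↔j`). -/
def symFlip (y : Cell) : Cell := (y.1, 1 - y.1 - y.2)

/-- Two constellations of the 2×2×3 board are isomorphic iff one is obtained from the
other by a symmetry of the board (the symmetry group is the Klein group generated by
`symMirror` and `symRot`). -/
def Iso223 (c c' : Pos) : Prop :=
  c' = c ∨ (∀ y, c' (symMirror y) = c y) ∨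
  (∀ y, c' (symRot y) = c y) ∨ (∀ y, c' (symFlip y) = c y)

end Abalone

namespace Abalone

/-! ### Computable move generation on the 2×2×3 board -/

/-- The cells of the 2×2×3 board, in alphabetical order of their labels. -/
def cells : List Cell := [ca, cb, cc, cd, ce, cf, cg, ch, ci, cj]

/-- Membership of a cell in the 2×2×3 board, by inequalities. -/
def onBoard (y : Cell) : Bool :=
  decide (-1 ≤ y.1) && decide (y.1 ≤ 1) && decide (-1 ≤ y.2) && decide (y.2 ≤ 2) &&
    decide (-1 ≤ y.1 + y.2) && decide (y.1 + y.2 ≤ 2)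

lemma onBoard_iff_mem_cells (y : Cell) : onBoard y = true ↔ y ∈ cells := by
  constructor
  · obtain ⟨q, r⟩ := y
    simp only [onBoard, Bool.and_eq_true, decide_eq_true_eq]
    rintro ⟨⟨⟨⟨⟨h1, h2⟩, h3⟩, h4⟩, h5⟩, h6⟩
    interval_cases q <;> interval_cases r <;> first | omega | decide
  · revert y
    decide

lemma mem_board223_iff (y : Cell) : y ∈ board223 ↔ onBoard y = true := by
  simp [onBoard_iff_mem_cells, board223, cells]

/-- The constellation vanishes outside the 2×2×3 board. -/
def Supported (c : Pos) : Prop := ∀ y, onBoard y = false → c y = none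

/-- Computable form of `shiftResult` on the 2×2×3 board. -/
def shiftPos (c : Pos) (x d : Cell) (len : ℕ) : Pos := fun y =>
  if onBoard y = false then none
  else if y = x then none
  else if (List.range len).any (fun i => y == stepc x (i + 1) d) then c (addc y (negd d))
  else c y

lemma shiftResult_board223 (c : Pos) (x d : Cell) (len : ℕ) :
    shiftResult board223 c x d len = shiftPos c x d len := by
  funext y
  have h : (∃ i : ℕ, 1 ≤ i ∧ i ≤ len ∧ y = stepc x i d) ↔
      (List.range len).any (fun i => y == stepc x (i + 1) d) = true := by
    simp only [List.any_eq_true, List.mem_range, beq_iff_eq]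
    constructor
    · rintro ⟨i, h1, h2, h3⟩
      exact ⟨i - 1, by omega, by rwa [Nat.sub_add_cancel h1]⟩
    · rintro ⟨i, h1, h2⟩
      exact ⟨i + 1, by omega, by omega, h2⟩
  simp only [shiftResult, shiftPos, mem_board223_iff, h, Bool.not_eq_true]

/-- Computable form of `broadResult` on the 2×2×3 board. -/
def broadPos (c : Pos) (pl : Bool) (x d e : Cell) (k : ℕ) : Pos := fun y =>
  if onBoard y = false then none
  else if (List.range k).any (fun i => y == stepc x i d) then none
  else if (List.range k).any (fun i => y == addc (stepc x i d) e) then some pl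
  else c y

lemma broadResult_eq_broadPos {c : Pos} (hc : Supported c) (pl : Bool) (x d e : Cell) (k : ℕ)
    (h : ∀ i < k, onBoard (addc (stepc x i d) e) = true) :
    broadResult c pl x d e k = broadPos c pl x d e k := by
  funext y
  simp only [broadResult, broadPos, List.any_eq_true, List.mem_range, beq_iff_eq]
  by_cases hy : onBoard y = false
  · have h' : ¬ ∃ i < k, y = addc (stepc x i d) e := by
      rintro ⟨i, hi, rfl⟩
      simp [h i hi] at hy
    simp [hy, h', hc y hy]
  · simp [hy]

/-- The cell `x` is on the board and has content `v`. -/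
def holds (c : Pos) (v : Option Bool) (x : Cell) : Bool := onBoard x && c x == v

lemma holds_iff (c : Pos) (v : Option Bool) (x : Cell) :
    holds c v x = true ↔ x ∈ board223 ∧ c x = v := by
  simp [holds, mem_board223_iff]

/-- The legality test for an in-line move. -/
def inlineOk (pl : Bool) (c : Pos) (x d : Cell) (k m : ℕ) : Bool :=
  (List.range k).all (fun i => holds c (some pl) (stepc x i d)) &&
  (List.range m).all (fun i => holds c (some (!pl)) (stepc x (k + i) d)) &&
  (if m = 0 then holds c none (stepc x k d)
    else !onBoard (stepc x (k + m) d) || c (stepc x (k + m) d) == none)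

/-- The legality test for a broadside move. -/
def broadOk (pl : Bool) (c : Pos) (x d e : Cell) (k : ℕ) : Bool :=
  e != d && e != negd d &&
  (List.range k).all (fun i => holds c (some pl) (stepc x i d)) &&
  (List.range k).all (fun i => holds c none (addc (stepc x i d) e))

/-- The cells occupied by the marbles of player `pl`. -/
def marbles (pl : Bool) (c : Pos) : List Cell := cells.filter (fun x => c x == some pl)

/-- All results of in-line moves on the 2×2×3 board. -/
def inlineMoves (pl : Bool) (c : Pos) : List Pos :=
  (marbles pl c).flatMap fun x => dirs.flatMap fun d => [1, 2, 3].flatMap fun k =>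
    (List.range k).flatMap fun m =>
      if inlineOk pl c x d k m then [shiftPos c x d (k + m)] else []

/-- All results of broadside moves on the 2×2×3 board. -/
def broadMoves (pl : Bool) (c : Pos) : List Pos :=
  (marbles pl c).flatMap fun x => dirs.flatMap fun d => dirs.flatMap fun e =>
    [1, 2, 3].flatMap fun k => if broadOk pl c x d e k then [broadPos c pl x d e k] else []

/-- All results of legal moves on the 2×2×3 board. -/
def moves (pl : Bool) (c : Pos) : List Pos := inlineMoves pl c ++ broadMoves pl c

lemma mem_marbles_iff (pl : Bool) (c : Pos) (x : Cell) :
    x ∈ marbles pl c ↔ x ∈ board223 ∧ c x = some pl := by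
  simp [marbles, mem_board223_iff, onBoard_iff_mem_cells]

lemma inlineOk_iff (pl : Bool) (c : Pos) (x d : Cell) (k m : ℕ) :
    inlineOk pl c x d k m = true ↔
    (∀ i < k, stepc x i d ∈ board223 ∧ c (stepc x i d) = some pl) ∧
    (∀ i, k ≤ i → i < k + m → stepc x i d ∈ board223 ∧ c (stepc x i d) = some (!pl)) ∧
    ((m = 0 ∧ stepc x k d ∈ board223 ∧ c (stepc x k d) = none) ∨
      (1 ≤ m ∧ (stepc x (k + m) d ∉ board223 ∨ c (stepc x (k + m) d) = none))) := by
  have h : (∀ i < m, stepc x (k + i) d ∈ board223 ∧ c (stepc x (k + i) d) = some (!pl)) ↔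
      ∀ i, k ≤ i → i < k + m → stepc x i d ∈ board223 ∧ c (stepc x i d) = some (!pl) := by
    constructor
    · intro h i h1 h2
      have := h (i - k) (by omega)
      rwa [Nat.add_sub_cancel' h1] at this
    · intro h i hi
      exact h (k + i) (by omega) (by omega)
  simp only [inlineOk, Bool.and_eq_true, List.all_eq_true, List.mem_range, holds_iff, ← h,
    and_assoc]
  refine and_congr_right fun _ => and_congr_right fun _ => ?_
  rcases Nat.eq_zero_or_pos m with rfl | hm
  · simp [holds_iff]
  · simp [hm.ne', Nat.one_le_iff_ne_zero, mem_board223_iff]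

lemma broadOk_iff (pl : Bool) (c : Pos) (x d e : Cell) (k : ℕ) :
    broadOk pl c x d e k = true ↔ e ≠ d ∧ e ≠ negd d ∧
    (∀ i < k, stepc x i d ∈ board223 ∧ c (stepc x i d) = some pl) ∧
    (∀ i < k, addc (stepc x i d) e ∈ board223 ∧ c (addc (stepc x i d) e) = none) := by
  simp only [broadOk, Bool.and_eq_true, List.all_eq_true, List.mem_range, holds_iff, and_assoc,
    bne_iff_ne]

lemma stepc_zero (x d : Cell) : stepc x 0 d = x := by simp [stepc]

lemma mem_one_two_three (k : ℕ) : k ∈ [1, 2, 3] ↔ 1 ≤ k ∧ k ≤ 3 := by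
  simp only [List.mem_cons, List.not_mem_nil, or_false]
  omega

lemma inlineMove_iff (pl : Bool) (c c' : Pos) :
    InlineMove board223 3 pl c c' ↔ c' ∈ inlineMoves pl c := by
  simp only [InlineMove, inlineMoves, List.mem_flatMap, mem_one_two_three, List.mem_range,
    mem_marbles_iff, shiftResult_board223, List.mem_ite_nil_right, List.mem_singleton,
    inlineOk_iff]
  constructor
  · rintro ⟨x, d, hd, k, m, h1, h2, h3, h4, h5, h6, rfl⟩
    exact ⟨x, stepc_zero x d ▸ h4 0 h1, d, hd, k, ⟨h1, h2⟩, m, h3, ⟨h4, h5, h6⟩, rfl⟩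
  · rintro ⟨x, -, d, hd, k, ⟨h1, h2⟩, m, h3, ⟨h4, h5, h6⟩, rfl⟩
    exact ⟨x, d, hd, k, m, h1, h2, h3, h4, h5, h6, rfl⟩

lemma broadsideMove_iff {c : Pos} (hc : Supported c) (pl : Bool) (c' : Pos) :
    BroadsideMove board223 3 pl c c' ↔ c' ∈ broadMoves pl c := by
  simp only [BroadsideMove, broadMoves, List.mem_flatMap, mem_one_two_three,
    mem_marbles_iff, List.mem_ite_nil_right, List.mem_singleton, broadOk_iff]
  constructor
  · rintro ⟨x, d, e, hd, he, h1, h2, k, h3, h4, h5, h6, rfl⟩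
    exact ⟨x, stepc_zero x d ▸ h5 0 h3, d, hd, e, he, k, ⟨h3, h4⟩, ⟨h1, h2, h5, h6⟩,
      broadResult_eq_broadPos hc pl x d e k fun i hi => (mem_board223_iff _).1 (h6 i hi).1⟩
  · rintro ⟨x, -, d, hd, e, he, k, ⟨h3, h4⟩, ⟨h1, h2, h5, h6⟩, rfl⟩
    exact ⟨x, d, e, hd, he, h1, h2, k, h3, h4, h5, h6,
      (broadResult_eq_broadPos hc pl x d e k
        fun i hi => (mem_board223_iff _).1 (h6 i hi).1).symm⟩

lemma move_iff {c : Pos} (hc : Supported c) (pl : Bool) (c' : Pos) :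
    Move board223 3 pl c c' ↔ c' ∈ moves pl c := by
  rw [Move, inlineMove_iff, broadsideMove_iff hc, moves, List.mem_append]

lemma supported_of_mem_moves {pl : Bool} {c c' : Pos} (h : c' ∈ moves pl c) :
    Supported c' := by
  intro y hy
  simp only [moves, inlineMoves, broadMoves, List.mem_append, List.mem_flatMap,
    List.mem_ite_nil_right, List.mem_singleton] at h
  rcases h with ⟨_, _, _, _, _, _, _, _, _, rfl⟩ | ⟨_, _, _, _, _, _, _, _, _, rfl⟩
  · simp [shiftPos, hy]
  · simp [broadPos, hy]

lemma countM_board223 (pl : Bool) (c : Pos) : countM board223 pl c = (marbles pl c).length := by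
  have hn : cells.Nodup := by decide
  have hb : board223 = cells.toFinset := by decide
  rw [countM, marbles, ← List.toFinset_card_of_nodup (hn.filter _), hb]
  congr 1
  ext y
  simp

/-- Player `pl` has lost a marble. -/
def lostMarble (pl : Bool) (c : Pos) : Bool := decide ((marbles pl c).length < 3)

lemma G223_win_iff (pl : Bool) (c : Pos) : G223.win pl c ↔ lostMarble (!pl) c = true := by
  simp [G223, Wins, countM_board223, lostMarble]

/-! ### Positions encoded by bit masks -/

/-- The index of a cell of the 2×2×3 board in the list `cells`. -/
def cellIndex (y : Cell) : ℕ := (3 * y.1 + 5 - y.2).toNat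

/-- The constellation encoded by a 20-bit number: the low ten bits mark the black marbles on
`a, …, j`, the high ten bits the gray ones. -/
def ofMask (n : ℕ) : Pos := fun y =>
  if onBoard y = false then none
  else if n.testBit (cellIndex y) then some true
  else if n.testBit (cellIndex y + 10) then some false
  else none

/-- The constellation `c` agrees on the board with the encoded one. -/
def hasMask (c : Pos) (n : ℕ) : Bool := cells.all fun y => c y == ofMask n y

lemma supported_ofMask (n : ℕ) : Supported (ofMask n) := fun y hy => by simp [ofMask, hy]

lemma eq_ofMask {c : Pos} (hc : Supported c) {n : ℕ} (h : hasMask c n = true) :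
    c = ofMask n := by
  funext y
  cases hy : onBoard y with
  | false => rw [hc y hy, supported_ofMask n y hy]
  | true =>
    simp only [hasMask, List.all_eq_true, beq_iff_eq] at h
    exact h y ((onBoard_iff_mem_cells y).1 hy)

lemma supported_mk3 {b₁ b₂ b₃ g₁ g₂ g₃ : Cell}
    (h : [b₁, b₂, b₃, g₁, g₂, g₃].all onBoard = true) :
    Supported (mk3 b₁ b₂ b₃ g₁ g₂ g₃) := by
  intro y hy
  simp only [List.all_eq_true] at h
  have hne : ∀ z ∈ [b₁, b₂, b₃, g₁, g₂, g₃], y ≠ z := by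
    rintro z hz rfl
    simp [h y hz] at hy
  simp only [List.mem_cons, List.not_mem_nil, or_false, forall_eq_or_imp, forall_eq] at hne
  simp [mk3, hne]

/-! ### Certificates -/

/-- `pq.2` arises by a Gray move from `pq.1`, and either ejects a black marble or leaves Black
only with moves into `good`. -/
def winStep (good : List (ℕ × ℕ)) (pq : ℕ × ℕ) : Bool :=
  !lostMarble false (ofMask pq.1) &&
  (moves false (ofMask pq.1)).any (fun c => hasMask c pq.2) &&
  (lostMarble true (ofMask pq.2) ||
    (!lostMarble false (ofMask pq.2) && !(moves true (ofMask pq.2)).isEmpty &&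
      (moves true (ofMask pq.2)).all fun c => good.any fun r => hasMask c r.1))

/-- Every entry of the list is a `winStep` into later entries. -/
def winCert : List (ℕ × ℕ) → Bool
  | [] => true
  | pq :: l => winStep l pq && winCert l

lemma fw_of_winStep {good : List (ℕ × ℕ)}
    (hgood : ∀ r ∈ good, G223.FW false false (ofMask r.1)) {pq : ℕ × ℕ}
    (h : winStep good pq = true) : G223.FW false false (ofMask pq.1) := by
  simp only [winStep, Bool.and_eq_true, Bool.or_eq_true, Bool.not_eq_true', List.any_eq_true,
    List.all_eq_true] at h
  obtain ⟨⟨hp, c, hc, hcq⟩, h⟩ := h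
  obtain rfl := eq_ofMask (supported_of_mem_moves hc) hcq
  refine .self _ (ofMask pq.2) (by simp [G223_win_iff, hp])
    ((move_iff (supported_ofMask _) _ _).2 hc) ?_
  rcases h with h | ⟨⟨hq, hne⟩, h⟩
  · exact .terminal _ _ ((G223_win_iff _ _).2 h)
  · refine .opp _ (by simp [G223_win_iff, hq]) ?_ ?_
    · obtain ⟨s, hs⟩ := List.exists_mem_of_ne_nil (moves true (ofMask pq.2))
        (by simpa using hne)
      exact ⟨s, (move_iff (supported_ofMask _) _ _).2 hs⟩
    · intro s hs
      have hs := (move_iff (supported_ofMask _) _ _).1 hs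
      obtain ⟨r, hr, hsr⟩ := h s hs
      rw [eq_ofMask (supported_of_mem_moves hs) hsr]
      exact hgood r hr

lemma fw_of_winCert {l : List (ℕ × ℕ)} (h : winCert l = true) :
    ∀ r ∈ l, G223.FW false false (ofMask r.1) := by
  induction l with
  | nil => simp
  | cons pq l ih =>
    rw [winCert, Bool.and_eq_true] at h
    exact List.forall_mem_cons.2 ⟨fw_of_winStep (ih h.2) h.1, ih h.2⟩

lemma win_of_fw_of_win {P : Type*} {G : AGame P} {pl turn : Bool} {p : P}
    (h : G.FW pl turn p) (hw : G.win (!pl) p) : G.win pl p := by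
  cases h with
  | terminal _ _ h => exact h
  | self _ _ h => exact absurd hw h
  | opp _ h => exact absurd hw h

/-- From every position of the list, Gray to move cannot eject a marble, and to each Gray move
Black has a reply that ejects a marble or returns to the list. -/
def trapCert (l : List ℕ) : Bool :=
  l.all fun n => !lostMarble true (ofMask n) && (moves false (ofMask n)).all fun q =>
    !lostMarble true q && (moves true q).any fun s =>
      !lostMarble true s && (lostMarble false s || l.any fun r => hasMask s r)

lemma not_fw_of_trapCert {l : List ℕ} (h : trapCert l = true) {turn : Bool} {c : Pos}
    (hfw : G223.FW false turn c) :
    (turn = false → ∀ n ∈ l, c ≠ ofMask n) ∧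
    (turn = true → ∀ n ∈ l, ¬ c ∈ moves false (ofMask n)) := by
  simp only [trapCert, Bool.and_eq_true, Bool.or_eq_true, Bool.not_eq_true', List.any_eq_true,
    List.all_eq_true] at h
  induction hfw with
  | terminal turn p hw =>
    rw [G223_win_iff] at hw
    constructor
    · rintro - n hn rfl
      simp [(h n hn).1] at hw
    · rintro - n hn hp
      simp [((h n hn).2 p hp).1] at hw
  | self p q _ hm _ ih =>
    refine ⟨?_, by simp⟩
    rintro - n hn rfl
    exact ih.2 rfl n hn ((move_iff (supported_ofMask n) _ _).1 hm)
  | opp p _ _ hall ih =>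
    refine ⟨by simp, ?_⟩
    rintro - n hn hp
    obtain ⟨-, s, hs, hsw, hs'⟩ := (h n hn).2 p hp
    have hm := (move_iff (supported_of_mem_moves hp) _ _).2 hs
    rcases hs' with hl | ⟨r, hr, hsr⟩
    · have hw := win_of_fw_of_win (hall s hm) ((G223_win_iff _ _).2 hl)
      rw [G223_win_iff] at hw
      simp [hsw] at hw
    · exact (ih s hm).1 rfl r hr (eq_ofMask (supported_of_mem_moves hs) hsr)

/-- Positions in which Gray to move wins, each with the result of a winning move. -/
def grayWins : List (ℕ × ℕ) :=
  [(140612, 148804), (140836, 149028), (140580, 25892), (140866, 149058), (140834, 156194),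
   (156193, 180801), (149060, 166468), (25764, 50372), (156228, 180804), (156196, 180804),
   (166212, 51524), (180741, 311813), (149088, 410208), (148580, 19556), (50820, 51844), (26180,
   50756), (26148, 50756), (180808, 229896), (401968, 794672), (410180, 802884), (410148,
   802852), (180548, 229636), (311820, 53768), (410178, 802882), (409698, 280672), (180802,
   51776), (156418, 27392), (156226, 27200), (155938, 26912), (155746, 26720), (410118, 281092),
   (311814, 53762), (156166, 27140), (155718, 26692), (51904, 180800), (51972, 573700), (51588,
   180484), (51780, 573508), (51396, 180292), (51724, 27140), (311873, 50752), (180545, 229633),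
   (311365, 53313), (311811, 50690), (149280, 410144), (148832, 409696), (26432, 287296),
   (25952, 286816), (149252, 410116), (148772, 409636), (50500, 311364), (50252, 99340), (26372,
   287236), (25924, 286788), (148802, 19776), (149026, 20000), (148770, 409634), (148578,
   19552), (50754, 99842), (50370, 99458), (25890, 286754), (148998, 19972), (148518, 19492),
   (25862, 286726), (19808, 280672), (20228, 281092), (20036, 23104), (19780, 22848), (20004,
   23072), (11316, 14384)]

/-- A set of positions from which Gray to move cannot force a win. -/
def grayTrap : List ℕ :=
  [25698, 27232, 29024, 134448, 140338, 140340, 140388, 140592, 141364, 142112, 156000, 271410,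
   286820, 394290, 548962]

lemma winCert_grayWins : winCert grayWins = true := by decide +kernel

lemma trapCert_grayTrap : trapCert grayTrap = true := by decide +kernel

lemma supported_C0 : Supported C0 := supported_mk3 (by decide)

lemma C1_eq_ofMask : C1 = ofMask 140388 := eq_ofMask (supported_mk3 (by decide)) (by decide)

lemma iso223_mirror_C1 : Iso223 (mk3 cj cf cg ch cd ca) C1 := by
  refine Or.inr (Or.inl ?_)
  rintro ⟨q, r⟩
  simp only [C1, mk3, symMirror, ca, cc, cd, cf, cg, ch, cj, Prod.mk.injEq]
  congr 1
  · rw [eq_iff_iff]; omega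
  · congr 1
    rw [eq_iff_iff]; omega

lemma mirror_C1_eq_ofMask : mk3 cj cf cg ch cd ca = ofMask 140896 :=
  eq_ofMask (supported_mk3 (by decide)) (by decide)

lemma first_moves :
    (moves true C0).any (fun c => hasMask c 140388) = true ∧
    (moves true C0).all (fun c => hasMask c 140388 || hasMask c 140896 ||
      grayWins.any fun r => hasMask c r.1) = true := by
  decide +kernel

end Abalone


open Abalone AGame in
/-- in 2×2×3 Abalone from the standard initial constellation `C0`
(Black on `c, g, j`; Gray on `a, d, h`), with Black moving first: moving to `C1`
(the right Black marble broadside into the middle column) is a legal, non-losing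
first move — Gray cannot force a win from `C1` — and every Black first move whose
result is not isomorphic to `C1` allows Gray (moving next) to force a win. -/
theorem first_move_C1 :
    Move board223 3 true C0 C1 ∧
    ¬ G223.FW false false C1 ∧
    (∀ c', Move board223 3 true C0 c' → ¬ Iso223 c' C1 → G223.FW false false c') := by
  obtain ⟨hany, hall⟩ := first_moves
  simp only [List.any_eq_true, List.all_eq_true, Bool.or_eq_true] at hany hall
  refine ⟨?_, fun h => ?_, fun c' hm hiso => ?_⟩
  · obtain ⟨c, hc, hc1⟩ := hany
    rw [C1_eq_ofMask, ← eq_ofMask (supported_of_mem_moves hc) hc1]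
    exact (move_iff supported_C0 _ _).2 hc
  · exact (not_fw_of_trapCert trapCert_grayTrap h).1 rfl 140388 (by decide) C1_eq_ofMask
  · have hc := (move_iff supported_C0 _ _).1 hm
    have hs := supported_of_mem_moves hc
    rcases hall c' hc with (h | h) | ⟨r, hr, h⟩
    · exact absurd (Or.inl (C1_eq_ofMask.trans (eq_ofMask hs h).symm)) hiso
    · rw [eq_ofMask hs h, ← mirror_C1_eq_ofMask] at hiso
      exact absurd iso223_mirror_C1 hiso
    · rw [eq_ofMask hs h]
      exact fw_of_winCert winCert_grayWins r hr
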